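/- arXiv:2309.15870 — 5 statements merged into one kernel-verified Lean document; each statement's English description precedes it below -/
import Mathlib

section
/- Let n ≥ 1, let A and B be nonnegative n×n real matrices, and let α, β be real numbers. Suppose y* ∈ Δ_n has all entries strictly positive and Ay* = αy*, and suppose x* ∈ Δ_n has all entries strictly positive and Bᵀx* = βx*. Then for every x ∈ Δ_n, e^A(x, y*) = α, and for every y ∈ Δ_n, e^B(x*, y) = β; in particular, (x*, y*) is a Nash equilibrium of the SRUC game (A, B). -/
open Finset

/-- Inner product `xᵀy`. -/
noncomputable def dotp {n : ℕ} (x y : Fin n → ℝ) : ℝ := ∑ i, x i * y i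

/-- Bilinear form `xᵀCy`. -/
noncomputable def quadForm {n : ℕ} (C : Matrix (Fin n) (Fin n) ℝ) (x y : Fin n → ℝ) : ℝ :=
  ∑ i, ∑ j, x i * C i j * y j

/-- The SRUC payoff `e^C(x,y) ∈ [0,∞]`. -/
noncomputable def payoff {n : ℕ} (C : Matrix (Fin n) (Fin n) ℝ) (x y : Fin n → ℝ) : ENNReal :=
  if 0 < dotp x y then ENNReal.ofReal (quadForm C x y / dotp x y)
  else if 0 < quadForm C x y then ⊤ else 0

/-- The standard simplex `Δ_n`. -/
def simplex (n : ℕ) : Set (Fin n → ℝ) := {x | (∀ i, 0 ≤ x i) ∧ ∑ i, x i = 1}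

/-- Nash equilibrium of the SRUC game `(A, B)`. -/
def IsNash {n : ℕ} (A B : Matrix (Fin n) (Fin n) ℝ) (xs ys : Fin n → ℝ) : Prop :=
  xs ∈ simplex n ∧ ys ∈ simplex n ∧
  (∀ x ∈ simplex n, payoff A x ys ≤ payoff A xs ys) ∧
  (∀ y ∈ simplex n, payoff B xs ys ≤ payoff B xs y)

/-- `C` is irreducible: `graph(C)` (edges `(i,j)` with `i ≠ j`, `C i j > 0`) is
strongly connected. -/
def MatIrreducible {n : ℕ} (C : Matrix (Fin n) (Fin n) ℝ) : Prop :=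
  ∀ i j : Fin n, Relation.ReflTransGen (fun a b => a ≠ b ∧ 0 < C a b) i j

theorem dotp_pos_of_mem_simplex {n : ℕ} {x y : Fin n → ℝ} (hx : x ∈ simplex n)
    (hy : ∀ i, 0 < y i) : 0 < dotp x y := by
  obtain ⟨i, -, hi⟩ : ∃ i ∈ univ, 0 < x i := by
    apply exists_lt_of_sum_lt
    simp [hx.2]
  exact sum_pos' (fun j _ => mul_nonneg (hx.1 j) (hy j).le) ⟨i, mem_univ i, mul_pos hi (hy i)⟩

theorem dotp_comm {n : ℕ} (x y : Fin n → ℝ) : dotp x y = dotp y x :=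
  dotProduct_comm x y

theorem quadForm_eq_dotp_mulVec {n : ℕ} (C : Matrix (Fin n) (Fin n) ℝ) (x y : Fin n → ℝ) :
    quadForm C x y = dotp x (C.mulVec y) := by
  simp only [quadForm, dotp, Matrix.mulVec, dotProduct, mul_sum, mul_assoc]

theorem quadForm_transpose {n : ℕ} (C : Matrix (Fin n) (Fin n) ℝ) (x y : Fin n → ℝ) :
    quadForm C.transpose x y = quadForm C y x := by
  unfold quadForm
  rw [sum_comm]
  refine sum_congr rfl fun i _ => sum_congr rfl fun j _ => ?_
  rw [Matrix.transpose_apply]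
  ring

theorem payoff_transpose {n : ℕ} (C : Matrix (Fin n) (Fin n) ℝ) (x y : Fin n → ℝ) :
    payoff C.transpose x y = payoff C y x := by
  rw [payoff, payoff, quadForm_transpose, dotp_comm]

/-- Against a strictly positive eigenvector, every strategy earns the eigenvalue. -/
theorem payoff_eq_of_mulVec_eq_smul {n : ℕ} {C : Matrix (Fin n) (Fin n) ℝ} {c : ℝ}
    {x y : Fin n → ℝ} (hx : x ∈ simplex n) (hy : ∀ i, 0 < y i) (hC : C.mulVec y = c • y) :
    payoff C x y = ENNReal.ofReal c := by
  have hpos := dotp_pos_of_mem_simplex hx hy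
  have hquad : quadForm C x y = c * dotp x y := by
    rw [quadForm_eq_dotp_mulVec, hC]
    exact dotProduct_smul c x y
  rw [payoff, if_pos hpos, hquad, mul_div_cancel_right₀ _ hpos.ne']

theorem stmt1 (n : ℕ) (hn : 1 ≤ n) (A B : Matrix (Fin n) (Fin n) ℝ)
    (hA : ∀ i j, 0 ≤ A i j) (hB : ∀ i j, 0 ≤ B i j)
    (α β : ℝ) (xs ys : Fin n → ℝ)
    (hys : ys ∈ simplex n) (hyspos : ∀ i, 0 < ys i)
    (hAy : A.mulVec ys = α • ys)
    (hxs : xs ∈ simplex n) (hxspos : ∀ i, 0 < xs i)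
    (hBx : B.transpose.mulVec xs = β • xs) :
    (∀ x ∈ simplex n, payoff A x ys = ENNReal.ofReal α) ∧
    (∀ y ∈ simplex n, payoff B xs y = ENNReal.ofReal β) ∧
    IsNash A B xs ys := by
  have hpayA : ∀ x ∈ simplex n, payoff A x ys = ENNReal.ofReal α := fun x hx =>
    payoff_eq_of_mulVec_eq_smul hx hyspos hAy
  have hpayB : ∀ y ∈ simplex n, payoff B xs y = ENNReal.ofReal β := fun y hy => by
    rw [← payoff_transpose]
    exact payoff_eq_of_mulVec_eq_smul hy hxspos hBx
  exact ⟨hpayA, hpayB, hxs, hys, fun x hx => ((hpayA x hx).trans (hpayA xs hxs).symm).le,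
    fun y hy => ((hpayB ys hys).trans (hpayB y hy).symm).le⟩
end

section
/- Let n ≥ 1, let A and B be nonnegative n×n real matrices with A irreducible and graph(A) a subgraph of graph(B), and let (x*, y*) be a Nash equilibrium of the SRUC game (A, B). Then y* has full support, i.e., y*_i > 0 for every i ∈ {1,…,n}. -/
open Finset

lemma dotp_nonneg {n : ℕ} {x y : Fin n → ℝ} (hx : ∀ i, 0 ≤ x i) (hy : ∀ i, 0 ≤ y i) :
    0 ≤ dotp x y :=
  sum_nonneg fun i _ => mul_nonneg (hx i) (hy i)

lemma quadForm_pos_iff {n : ℕ} {C : Matrix (Fin n) (Fin n) ℝ} {x y : Fin n → ℝ}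
    (hC : ∀ i j, 0 ≤ C i j) (hx : ∀ i, 0 ≤ x i) (hy : ∀ i, 0 ≤ y i) :
    0 < quadForm C x y ↔ ∃ i j, 0 < x i * C i j * y j := by
  have h : ∀ i j, 0 ≤ x i * C i j * y j :=
    fun i j => mul_nonneg (mul_nonneg (hx i) (hC i j)) (hy j)
  unfold quadForm
  rw [sum_pos_iff_of_nonneg fun i _ => sum_nonneg fun j _ => h i j]
  simp only [sum_pos_iff_of_nonneg fun j _ => h _ j, mem_univ, true_and]

lemma payoff_eq_top_iff {n : ℕ} {C : Matrix (Fin n) (Fin n) ℝ} {x y : Fin n → ℝ} :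
    payoff C x y = ⊤ ↔ ¬ 0 < dotp x y ∧ 0 < quadForm C x y := by
  unfold payoff
  split_ifs <;> simp_all

lemma payoff_self_ne_top {n : ℕ} {C : Matrix (Fin n) (Fin n) ℝ} {x : Fin n → ℝ}
    (hx : x ∈ simplex n) : payoff C x x ≠ ⊤ := by
  rw [Ne, payoff_eq_top_iff]
  rintro ⟨h, -⟩
  refine h (lt_of_le_of_ne (dotp_nonneg hx.1 hx.1) fun h0 => ?_)
  have hz : ∀ i, x i = 0 := by
    simpa [dotp, sum_eq_zero_iff_of_nonneg fun i _ => mul_self_nonneg (x i)] using h0.symm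
  simpa [hz] using hx.2

/-- An irreducible matrix has an edge entering the support of any point of the simplex that
does not have full support. -/
lemma MatIrreducible.exists_edge_into_support {n : ℕ} {C : Matrix (Fin n) (Fin n) ℝ}
    (hC : MatIrreducible C) {y : Fin n → ℝ} (hy : y ∈ simplex n) {i : Fin n} (hi : y i = 0) :
    ∃ a b, y a = 0 ∧ 0 < y b ∧ 0 < C a b := by
  by_contra! h
  have hz : ∀ j, y j = 0 := fun j => by
    induction hC i j with
    | refl => exact hi
    | tail _ hab ih =>
      by_contra hb
      exact (h _ _ ih (lt_of_le_of_ne (hy.1 _) (Ne.symm hb))).not_gt hab.2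
  simpa [hz] using hy.2

/-- A maximiser facing a point without full support can force an infinite payoff. -/
lemma MatIrreducible.exists_payoff_eq_top {n : ℕ} {C : Matrix (Fin n) (Fin n) ℝ}
    (hC : MatIrreducible C) (hC0 : ∀ i j, 0 ≤ C i j) {y : Fin n → ℝ} (hy : y ∈ simplex n)
    {i : Fin n} (hi : y i = 0) : ∃ x ∈ simplex n, payoff C x y = ⊤ := by
  obtain ⟨a, b, ha, hb, hab⟩ := hC.exists_edge_into_support hy hi
  have hx : ∀ k, 0 ≤ (Pi.single a 1 : Fin n → ℝ) k := fun k => by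
    rw [Pi.single_apply]; split_ifs <;> simp
  refine ⟨Pi.single a 1, ⟨hx, by simp⟩, payoff_eq_top_iff.2 ⟨?_, ?_⟩⟩
  · simp [dotp, Pi.single_apply, ha]
  · exact (quadForm_pos_iff hC0 hx hy.1).2 ⟨a, b, by simpa using mul_pos hab hb⟩

/-- An infinite payoff stays infinite when the graph of the matrix is enlarged. -/
lemma payoff_eq_top_of_subgraph {n : ℕ} {A B : Matrix (Fin n) (Fin n) ℝ}
    (hA : ∀ i j, 0 ≤ A i j) (hB : ∀ i j, 0 ≤ B i j)
    (hsub : ∀ i j : Fin n, i ≠ j → 0 < A i j → 0 < B i j) {x y : Fin n → ℝ}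
    (hx : ∀ i, 0 ≤ x i) (hy : ∀ i, 0 ≤ y i) (h : payoff A x y = ⊤) : payoff B x y = ⊤ := by
  obtain ⟨hd, hq⟩ := payoff_eq_top_iff.1 h
  obtain ⟨i, j, hij⟩ := (quadForm_pos_iff hA hx hy).1 hq
  have hyj : 0 < y j := (hy j).lt_of_ne' (right_ne_zero_of_mul hij.ne')
  have hxA := left_ne_zero_of_mul hij.ne'
  have hxi : 0 < x i := (hx i).lt_of_ne' (left_ne_zero_of_mul hxA)
  have hAij : 0 < A i j := (hA i j).lt_of_ne' (right_ne_zero_of_mul hxA)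
  have hne : i ≠ j := by
    rintro rfl
    exact hd (sum_pos' (fun k _ => mul_nonneg (hx k) (hy k)) ⟨i, mem_univ i, mul_pos hxi hyj⟩)
  exact payoff_eq_top_iff.2 ⟨hd, (quadForm_pos_iff hB hx hy).2
    ⟨i, j, mul_pos (mul_pos hxi (hsub i j hne hAij)) hyj⟩⟩

theorem stmt3 (n : ℕ) (hn : 1 ≤ n) (A B : Matrix (Fin n) (Fin n) ℝ)
    (hA : ∀ i j, 0 ≤ A i j) (hB : ∀ i j, 0 ≤ B i j)
    (hAirr : MatIrreducible A)
    (hsub : ∀ i j : Fin n, i ≠ j → 0 < A i j → 0 < B i j)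
    (xs ys : Fin n → ℝ) (hne : IsNash A B xs ys) :
    ∀ i, 0 < ys i := by
  obtain ⟨hxs, hys, hmax, hmin⟩ := hne
  intro i
  refine (hys.1 i).lt_of_ne' fun hi => ?_
  obtain ⟨x, hx, hxtop⟩ := hAirr.exists_payoff_eq_top hA hys hi
  have hAtop : payoff A xs ys = ⊤ := top_le_iff.1 (hxtop ▸ hmax x hx)
  have hBtop := payoff_eq_top_of_subgraph hA hB hsub hxs.1 hys.1 hAtop
  exact payoff_self_ne_top hxs (top_le_iff.1 (hBtop ▸ hmin xs hxs))
end

section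
/- Let n ≥ 1, let A and B be nonnegative n×n real matrices with B irreducible, and let (x*, y*) be a Nash equilibrium of the SRUC game (A, B) such that y* has full support (y*_i > 0 for all i). Then x* has full support, i.e., x*_i > 0 for every i ∈ {1,…,n}. -/
open Finset

theorem simplex_single {n : ℕ} (j : Fin n) : Pi.single j 1 ∈ simplex n := by
  refine ⟨fun i => ?_, by simp⟩
  by_cases h : i = j
  · subst h; simp
  · simp [h]

theorem dotp_single {n : ℕ} (x : Fin n → ℝ) (j : Fin n) :
    dotp x (Pi.single j 1) = x j := by
  simp [dotp, Pi.single_apply]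

theorem quadForm_single {n : ℕ} (C : Matrix (Fin n) (Fin n) ℝ) (x : Fin n → ℝ) (j : Fin n) :
    quadForm C x (Pi.single j 1) = ∑ i, x i * C i j := by
  simp [quadForm, Pi.single_apply]

theorem quadForm_eq_sum_column {n : ℕ} (C : Matrix (Fin n) (Fin n) ℝ) (x y : Fin n → ℝ) :
    quadForm C x y = ∑ j, (∑ i, x i * C i j) * y j := by
  rw [quadForm, Finset.sum_comm]
  simp only [Finset.sum_mul]

theorem simplex_exists_pos {n : ℕ} {x : Fin n → ℝ} (hx : x ∈ simplex n) : ∃ i, 0 < x i := by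
  by_contra! h
  have := Finset.sum_nonpos fun i (_ : i ∈ Finset.univ) => h i
  linarith [hx.2]

/-- If a full-support `y` minimizes the payoff against `x`, then `x` is a left eigenvector
of `C` for the value of the payoff. -/
theorem sum_column_eq_of_minimizer {n : ℕ} {C : Matrix (Fin n) (Fin n) ℝ}
    (hC : ∀ i j, 0 ≤ C i j) {x y : Fin n → ℝ} (hx : ∀ i, 0 ≤ x i) (hy : ∀ i, 0 < y i)
    (hxy : 0 < dotp x y) (hmin : ∀ z ∈ simplex n, payoff C x y ≤ payoff C x z) (j : Fin n) :
    ∑ i, x i * C i j = quadForm C x y / dotp x y * x j := by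
  set r := quadForm C x y / dotp x y with hr
  have col_nonneg (j : Fin n) : 0 ≤ ∑ i, x i * C i j :=
    Finset.sum_nonneg fun i _ => mul_nonneg (hx i) (hC i j)
  have le_col (j : Fin n) : r * x j ≤ ∑ i, x i * C i j := by
    rcases (hx j).eq_or_lt with h | h
    · simpa [← h] using col_nonneg j
    · have := hmin _ (simplex_single j)
      rw [payoff, payoff, dotp_single, quadForm_single, if_pos hxy, if_pos h,
        ENNReal.ofReal_le_ofReal_iff (div_nonneg (col_nonneg j) h.le)] at this
      exact (le_div_iff₀ h).1 this
  have sum_zero : ∑ j, (∑ i, x i * C i j - r * x j) * y j = 0 := by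
    have : r * dotp x y = quadForm C x y := div_mul_cancel₀ _ hxy.ne'
    rw [quadForm_eq_sum_column, dotp, Finset.mul_sum] at this
    simp only [sub_mul, Finset.sum_sub_distrib, mul_assoc r]
    linarith
  have := (Finset.sum_eq_zero_iff_of_nonneg fun j _ =>
    mul_nonneg (sub_nonneg.2 (le_col j)) (hy j).le).1 sum_zero j (Finset.mem_univ j)
  exact sub_eq_zero.1 ((mul_eq_zero.1 this).resolve_right (hy j).ne')

theorem stmt4 (n : ℕ) (hn : 1 ≤ n) (A B : Matrix (Fin n) (Fin n) ℝ)
    (hA : ∀ i j, 0 ≤ A i j) (hB : ∀ i j, 0 ≤ B i j)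
    (hBirr : MatIrreducible B)
    (xs ys : Fin n → ℝ) (hne : IsNash A B xs ys)
    (hyfull : ∀ i, 0 < ys i) :
    ∀ i, 0 < xs i := by
  obtain ⟨hx, -, -, hmin⟩ := hne
  obtain ⟨k, hk⟩ := simplex_exists_pos hx
  have hxy : 0 < dotp xs ys :=
    Finset.sum_pos' (fun i _ => mul_nonneg (hx.1 i) (hyfull i).le)
      ⟨k, Finset.mem_univ k, mul_pos hk (hyfull k)⟩
  intro i
  induction hBirr k i with
  | refl => exact hk
  | @tail a b _ hab ha =>
    refine (hx.1 b).lt_of_ne' fun h => ?_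
    have hcol := sum_column_eq_of_minimizer hB hx.1 hyfull hxy hmin b
    rw [h, mul_zero, Finset.sum_eq_zero_iff_of_nonneg
      fun i _ => mul_nonneg (hx.1 i) (hB i b)] at hcol
    exact (mul_pos ha hab.2).ne' (hcol a (Finset.mem_univ a))
end

section
/- Let A be the 2×2 matrix with A_{1,1} = 1, A_{2,2} = 2, and A_{1,2} = A_{2,1} = 0. Then for x, y ∈ Δ_2, the pair (x, y) is a Nash equilibrium of the SRUC game (A, A) if and only if x₁ > 0, x₂ > 0, and y = (1, 0). -/
open Finset

theorem payoff_diag_one_two (x y : Fin 2 → ℝ) :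
    payoff !![(1 : ℝ), 0; 0, 2] x y =
      if 0 < x 0 * y 0 + x 1 * y 1 then
        ENNReal.ofReal ((x 0 * y 0 + x 1 * 2 * y 1) / (x 0 * y 0 + x 1 * y 1))
      else if 0 < x 0 * y 0 + x 1 * 2 * y 1 then ⊤ else 0 := by
  simp [payoff, dotp, quadForm, Fin.sum_univ_two]

theorem payoff_diag_one_two_fst_right {x : Fin 2 → ℝ} :
    payoff !![(1 : ℝ), 0; 0, 2] x ![1, 0] = if 0 < x 0 then 1 else 0 := by
  rw [payoff_diag_one_two]
  by_cases h : 0 < x 0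
  · simp [h, h.ne']
  · simp [h]

theorem payoff_diag_one_two_snd_left {y : Fin 2 → ℝ} (hy : 0 < y 1) :
    payoff !![(1 : ℝ), 0; 0, 2] ![0, 1] y = 2 := by
  rw [payoff_diag_one_two]
  simp [hy, hy.ne']

theorem payoff_diag_one_two_snd_right_eq_zero {x : Fin 2 → ℝ} (hx : x 1 = 0) :
    payoff !![(1 : ℝ), 0; 0, 2] x ![0, 1] = 0 := by
  rw [payoff_diag_one_two]
  simp [hx]

theorem one_le_payoff_diag_one_two {x y : Fin 2 → ℝ} (hx₀ : 0 < x 0) (hx₁ : 0 < x 1)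
    (hy : y ∈ simplex 2) : 1 ≤ payoff !![(1 : ℝ), 0; 0, 2] x y := by
  obtain ⟨hy_nonneg, hy_sum⟩ := hy
  rw [Fin.sum_univ_two] at hy_sum
  have h₀ := mul_nonneg hx₀.le (hy_nonneg 0)
  have h₁ := mul_nonneg hx₁.le (hy_nonneg 1)
  have hpos : 0 < x 0 * y 0 + x 1 * y 1 := by
    rcases (hy_nonneg 0).eq_or_lt with h | h
    · have : y 1 = 1 := by linarith
      rw [this] at h₁ ⊢
      linarith
    · have := mul_pos hx₀ h
      linarith
  rw [payoff_diag_one_two, if_pos hpos, ENNReal.one_le_ofReal, one_le_div hpos]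
  linarith

theorem fst_mem_simplex_two : ![1, 0] ∈ simplex 2 := by
  simp [simplex, Fin.forall_fin_two]

theorem snd_mem_simplex_two : ![0, 1] ∈ simplex 2 := by
  simp [simplex, Fin.forall_fin_two]

theorem stmt10 (x y : Fin 2 → ℝ) (hx : x ∈ simplex 2) (hy : y ∈ simplex 2) :
    IsNash !![(1 : ℝ), 0; 0, 2] !![(1 : ℝ), 0; 0, 2] x y ↔
      (0 < x 0 ∧ 0 < x 1 ∧ y = ![1, 0]) := by
  constructor
  · rintro ⟨-, -, hmax, hmin⟩
    have hy₁ : y 1 = 0 := by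
      by_contra hne
      have hpos : 0 < y 1 := lt_of_le_of_ne (hy.1 1) (Ne.symm hne)
      have h := (hmax _ snd_mem_simplex_two).trans (hmin _ fst_mem_simplex_two)
      rw [payoff_diag_one_two_snd_left hpos, payoff_diag_one_two_fst_right] at h
      split_ifs at h <;> norm_num at h
    have hy₀ : y 0 = 1 := by
      have := hy.2
      rw [Fin.sum_univ_two] at this
      linarith
    have hy_eq : y = ![1, 0] := by
      ext i
      fin_cases i <;> simp [hy₀, hy₁]
    subst hy_eq
    refine ⟨?_, ?_, rfl⟩
    · by_contra hx₀
      have h := hmax _ fst_mem_simplex_two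
      rw [payoff_diag_one_two_fst_right, payoff_diag_one_two_fst_right, if_neg hx₀] at h
      simp at h
    · by_contra hx₁
      have h := (hmax _ fst_mem_simplex_two).trans (hmin _ snd_mem_simplex_two)
      rw [payoff_diag_one_two_snd_right_eq_zero (le_antisymm (not_lt.mp hx₁) (hx.1 1)),
        payoff_diag_one_two_fst_right] at h
      simp at h
  · rintro ⟨hx₀, hx₁, rfl⟩
    refine ⟨hx, hy, fun x' _ => ?_, fun y' hy' => ?_⟩
    · rw [payoff_diag_one_two_fst_right, payoff_diag_one_two_fst_right, if_pos hx₀]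
      split_ifs <;> simp
    · rw [payoff_diag_one_two_fst_right, if_pos hx₀]
      exact one_le_payoff_diag_one_two hx₀ hx₁ hy'
end

section
/- Let n ≥ 1 and let s ∈ ℝ^n satisfy 0 < s_1 ≤ s_2 ≤ … ≤ s_n. Define g(z) := Σ_{i=1}^n s_i/(z + s_i) for z ≥ 0, and let r := Σ_{i=1}^n s_i. Then g is strictly monotonically decreasing on [0, ∞), there exists a unique ρ ∈ [0, ∞) with g(ρ) = 1, and this ρ satisfies r − s_n ≤ ρ ≤ r − s_1. -/
open Finset

theorem stmt14 (n : ℕ) (hn : 1 ≤ n) (s : Fin n → ℝ)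
    (hpos : ∀ i, 0 < s i) (hmono : Monotone s)
    (g : ℝ → ℝ) (hg : ∀ z, g z = ∑ i, s i / (z + s i))
    (r : ℝ) (hr : r = ∑ i, s i) :
    StrictAntiOn g (Set.Ici (0 : ℝ)) ∧
    ∃ ρ : ℝ, (0 ≤ ρ ∧ g ρ = 1) ∧
      (∀ ρ' : ℝ, 0 ≤ ρ' → g ρ' = 1 → ρ' = ρ) ∧
      r - s ⟨n - 1, by omega⟩ ≤ ρ ∧ ρ ≤ r - s ⟨0, hn⟩ := by
  have hne : Nonempty (Fin n) := ⟨⟨0, hn⟩⟩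
  obtain rfl : g = fun z => ∑ i, s i / (z + s i) := funext hg
  have hanti : StrictAntiOn (fun z : ℝ => ∑ i, s i / (z + s i)) (Set.Ici (0 : ℝ)) := by
    intro x hx y _ hxy
    have hx0 : 0 ≤ x := hx
    refine Finset.sum_lt_sum_of_nonempty Finset.univ_nonempty fun i _ => ?_
    exact div_lt_div_of_pos_left (hpos i) (by linarith [hpos i]) (by linarith)
  have hle (i : Fin n) : s i ≤ r :=
    hr ▸ Finset.single_le_sum (fun j _ => (hpos j).le) (Finset.mem_univ i)
  have hmin (i : Fin n) : s ⟨0, hn⟩ ≤ s i := hmono (Fin.mk_le_of_le_val (Nat.zero_le _))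
  have hmax (i : Fin n) : s i ≤ s ⟨n - 1, by omega⟩ :=
    hmono (Fin.le_def.2 (Nat.le_sub_one_of_lt i.isLt))
  have hlow : 0 ≤ r - s ⟨n - 1, by omega⟩ := sub_nonneg.2 (hle _)
  have hrpos : 0 < r := (hpos ⟨0, hn⟩).trans_le (hle _)
  have hsum : ∑ i, s i / r = 1 := by
    rw [← Finset.sum_div, ← hr, div_self hrpos.ne']
  have hcont : ContinuousOn (fun z : ℝ => ∑ i, s i / (z + s i))
      (Set.Icc (r - s ⟨n - 1, by omega⟩) (r - s ⟨0, hn⟩)) := by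
    refine continuousOn_finsetSum _ fun i _ => ?_
    refine continuousOn_const.div (continuousOn_id.add continuousOn_const) fun z hz => ?_
    exact (add_pos_of_nonneg_of_pos (hlow.trans hz.1) (hpos i)).ne'
  have hlower : 1 ≤ ∑ i, s i / (r - s ⟨n - 1, by omega⟩ + s i) := by
    rw [← hsum]
    refine Finset.sum_le_sum fun i _ => ?_
    exact div_le_div_of_nonneg_left (hpos i).le (by linarith [hpos i]) (by linarith [hmax i])
  have hupper : ∑ i, s i / (r - s ⟨0, hn⟩ + s i) ≤ 1 := by
    rw [← hsum]
    refine Finset.sum_le_sum fun i _ => ?_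
    exact div_le_div_of_nonneg_left (hpos i).le hrpos (by linarith [hmin i])
  obtain ⟨ρ, hρ, hρ1⟩ :=
    intermediate_value_Icc' (sub_le_sub_left (hmin _) r) hcont ⟨hupper, hlower⟩
  have hρ0 : 0 ≤ ρ := hlow.trans hρ.1
  exact ⟨hanti, ρ, ⟨hρ0, hρ1⟩,
    fun ρ' h0 h1 => hanti.injOn h0 hρ0 (h1.trans hρ1.symm), hρ.1, hρ.2⟩
end
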